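/- arXiv:2605.23430 — 6 statements merged into one kernel-verified Lean document; each statement's English description precedes it below -/
import Mathlib

section
/- (Penner's theorem, Lorentzian form.) Let n ≥ 2 and let v₁, v₂, …, v_{n+1} be lightlike vectors in Lorentzian space ℝ^{n,1}, each with positive last coordinate. Let A be the (n+1)×(n+1) matrix with entries A_{ij} = −⟨v_i, v_j⟩. Then det A = 0 if and only if there exists a spacelike vector w with ⟨v_i, w⟩ = 0 for all i = 1, …, n+1 (that is, if and only if the lines through the v_i all lie in the Lorentz-orthogonal complement of a single spacelike vector, meaning the horosphere centres lie on the ideal boundary of a common hyperplane). -/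
/-- The Lorentzian bilinear form on `ℝ^{n,1}`:
`⟨x,y⟩ = x₁y₁ + ⋯ + xₙyₙ − x_{n+1}y_{n+1}`. -/
def lorentz {n : ℕ} (x y : Fin (n + 1) → ℝ) : ℝ :=
  (∑ i : Fin n, x i.castSucc * y i.castSucc) - x (Fin.last n) * y (Fin.last n)

theorem lorentz_eq_sum {n : ℕ} (x y : Fin (n + 1) → ℝ) :
    lorentz x y = ∑ j, x j * (if j = Fin.last n then -1 else 1) * y j := by
  rw [Fin.sum_univ_castSucc]
  simp [lorentz, (Fin.castSucc_lt_last _).ne, sub_eq_add_neg]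

theorem lorentz_smul_left {n : ℕ} (c : ℝ) (x y : Fin (n + 1) → ℝ) :
    lorentz (c • x) y = c * lorentz x y := by
  simp only [lorentz_eq_sum, Finset.mul_sum, Pi.smul_apply, smul_eq_mul]
  exact Finset.sum_congr rfl fun j _ => by ring

/-- The Gram matrix of `n + 1` vectors of `ℝ^{n,1}` is singular iff some nonzero vector is
Lorentz-orthogonal to all of them. -/
theorem det_neg_lorentz_eq_zero_iff {n : ℕ} (v : Fin (n + 1) → (Fin (n + 1) → ℝ)) :
    Matrix.det (Matrix.of fun i j : Fin (n + 1) => -(lorentz (v i) (v j))) = 0 ↔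
      ∃ w : Fin (n + 1) → ℝ, w ≠ 0 ∧ ∀ i, lorentz (v i) w = 0 := by
  set V : Matrix (Fin (n + 1)) (Fin (n + 1)) ℝ := Matrix.of v with hV
  set D : Matrix (Fin (n + 1)) (Fin (n + 1)) ℝ :=
    Matrix.diagonal fun j => if j = Fin.last n then -1 else 1 with hD
  have hgram : (Matrix.of fun i j : Fin (n + 1) => -(lorentz (v i) (v j))) =
      -(V * D * V.transpose) := by
    ext i j
    simp only [hV, hD, Matrix.neg_apply, Matrix.of_apply, Matrix.mul_apply (M := _ * _),
      Matrix.mul_diagonal, Matrix.transpose_apply, lorentz_eq_sum]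
  have hmulVec (w : Fin (n + 1) → ℝ) : (V * D).mulVec w = fun i => lorentz (v i) w := by
    ext i
    simp only [hV, hD, Matrix.mulVec, dotProduct, Matrix.mul_diagonal, Matrix.of_apply,
      lorentz_eq_sum]
  have hdet : D.det ≠ 0 := by
    rw [hD, Matrix.det_diagonal, Finset.prod_ne_zero_iff]
    intro j _
    split_ifs <;> norm_num
  have hiff : Matrix.det (-(V * D * V.transpose)) = 0 ↔ (V * D).det = 0 := by
    rw [Matrix.det_neg, Matrix.det_mul (V * D), Matrix.det_transpose, Matrix.det_mul V D]
    simp only [mul_eq_zero, hdet, or_false, or_self, pow_eq_zero_iff', neg_eq_zero, one_ne_zero,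
      false_and, false_or]
  rw [hgram, hiff, ← Matrix.exists_mulVec_eq_zero_iff]
  simp only [hmulVec, funext_iff, Pi.zero_apply, ne_eq]

/-- A lightlike vector orthogonal to a vector that is not spacelike is proportional to it. -/
theorem smul_eq_smul_of_lorentz_eq_zero {n : ℕ} {x w : Fin (n + 1) → ℝ}
    (hx : lorentz x x = 0) (hw : lorentz w w ≤ 0) (hxw : lorentz x w = 0) :
    x (Fin.last n) • w = w (Fin.last n) • x := by
  set s := x (Fin.last n) with hs
  set t := w (Fin.last n) with ht
  simp only [lorentz, ← hs, ← ht] at hx hw hxw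
  have hsum : ∑ i : Fin n, (s * w i.castSucc - t * x i.castSucc) ^ 2 =
      s ^ 2 * ∑ i : Fin n, w i.castSucc * w i.castSucc
        - 2 * s * t * ∑ i : Fin n, x i.castSucc * w i.castSucc
        + t ^ 2 * ∑ i : Fin n, x i.castSucc * x i.castSucc := by
    simp only [Finset.mul_sum, ← Finset.sum_sub_distrib, ← Finset.sum_add_distrib]
    exact Finset.sum_congr rfl fun i _ => by ring
  have hnonpos : ∑ i : Fin n, (s * w i.castSucc - t * x i.castSucc) ^ 2 ≤ 0 := by
    rw [hsum, sub_eq_zero.mp hx, sub_eq_zero.mp hxw]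
    nlinarith [mul_nonpos_of_nonneg_of_nonpos (sq_nonneg s) hw]
  have hzero := (Finset.sum_eq_zero_iff_of_nonneg fun i _ => sq_nonneg _).mp
    (le_antisymm hnonpos (Finset.sum_nonneg fun i _ => sq_nonneg _))
  ext j
  refine Fin.lastCases ?_ (fun i => ?_) j
  · simp only [Pi.smul_apply, smul_eq_mul, ← hs, ← ht, mul_comm]
  · exact sub_eq_zero.mp (pow_eq_zero_iff two_ne_zero |>.mp (hzero i (Finset.mem_univ i)))

/-- For `n ≥ 2`, every vector of `ℝ^{n,1}` is orthogonal to some spacelike vector. -/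
theorem exists_spacelike_lorentz_eq_zero {n : ℕ} (hn : 2 ≤ n) (w : Fin (n + 1) → ℝ) :
    ∃ u : Fin (n + 1) → ℝ, 0 < lorentz u u ∧ lorentz w u = 0 := by
  obtain ⟨m, rfl⟩ := Nat.exists_eq_add_of_le' hn
  have key (a b : ℝ) : ∃ u : Fin (m + 2 + 1) → ℝ,
      lorentz u u = a ^ 2 + b ^ 2 ∧ lorentz w u = w 0 * a + w 1 * b := by
    refine ⟨Fin.cons a (Fin.cons b 0), ?_, ?_⟩
    · simp [lorentz, Fin.sum_univ_succ, ← Fin.succ_last, sq]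
    · simp [lorentz, Fin.sum_univ_succ, ← Fin.succ_last]
  by_cases h : w 0 = 0
  · obtain ⟨u, hu, hwu⟩ := key 1 0
    exact ⟨u, by rw [hu]; norm_num, by rw [hwu, h]; ring⟩
  · obtain ⟨u, hu, hwu⟩ := key (-w 1) (w 0)
    exact ⟨u, by rw [hu]; positivity, by rw [hwu]; ring⟩

/-- Penner's theorem, Lorentzian form: for lightlike vectors
`v₁, …, v_{n+1}` in `ℝ^{n,1}` with positive last coordinate, `det A = 0`,
where `A_{ij} = −⟨v_i, v_j⟩`, iff there is a spacelike vector `w` with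
`⟨v_i, w⟩ = 0` for all `i`. -/
theorem stmt4 (n : ℕ) (hn : 2 ≤ n) (v : Fin (n + 1) → (Fin (n + 1) → ℝ))
    (hlight : ∀ i, lorentz (v i) (v i) = 0)
    (hpos : ∀ i, 0 < v i (Fin.last n)) :
    Matrix.det (Matrix.of fun i j : Fin (n + 1) => -(lorentz (v i) (v j))) = 0 ↔
      ∃ w : Fin (n + 1) → ℝ, 0 < lorentz w w ∧ ∀ i, lorentz (v i) w = 0 := by
  rw [det_neg_lorentz_eq_zero_iff]
  constructor
  · rintro ⟨w, hw0, hw⟩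
    rcases lt_or_ge 0 (lorentz w w) with hww | hww
    · exact ⟨w, hww, hw⟩
    have hprop i := smul_eq_smul_of_lorentz_eq_zero (hlight i) hww (hw i)
    have ht : w (Fin.last n) ≠ 0 := by
      intro ht
      have h := hprop 0
      rw [ht, zero_smul, smul_eq_zero] at h
      exact h.elim (hpos 0).ne' hw0
    obtain ⟨u, hu, hwu⟩ := exists_spacelike_lorentz_eq_zero hn w
    refine ⟨u, hu, fun i => ?_⟩
    have h := lorentz_smul_left (w (Fin.last n)) (v i) u
    rw [← hprop i, lorentz_smul_left, hwu, mul_zero] at h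
    exact (mul_eq_zero.mp h.symm).resolve_left ht
  · rintro ⟨w, hww, hw⟩
    refine ⟨w, ?_, hw⟩
    rintro rfl
    simp [lorentz] at hww
end

section
/- Let λ₁₂, λ₁₃, λ₁₄, λ₂₃, λ₂₄, λ₃₄ be real numbers and let A be the symmetric 4×4 matrix with zero diagonal whose (i,j) entry for i < j is λ_{ij}². Then det A = −(λ₁₄λ₂₃ + λ₁₃λ₂₄ − λ₁₂λ₃₄)(λ₁₄λ₂₃ − λ₁₃λ₂₄ + λ₁₂λ₃₄)(−λ₁₄λ₂₃ + λ₁₃λ₂₄ + λ₁₂λ₃₄)(λ₁₄λ₂₃ + λ₁₃λ₂₄ + λ₁₂λ₃₄). -/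
/-- the determinant of the symmetric 4×4 matrix with zero diagonal and
off-diagonal entries `λ_{ij}²` factors into the four Ptolemy-type expressions. -/
theorem stmt5 (l12 l13 l14 l23 l24 l34 : ℝ) :
    Matrix.det !![0, l12 ^ 2, l13 ^ 2, l14 ^ 2;
                  l12 ^ 2, 0, l23 ^ 2, l24 ^ 2;
                  l13 ^ 2, l23 ^ 2, 0, l34 ^ 2;
                  l14 ^ 2, l24 ^ 2, l34 ^ 2, 0] =
      -((l14 * l23 + l13 * l24 - l12 * l34) * (l14 * l23 - l13 * l24 + l12 * l34) *
        (-(l14 * l23) + l13 * l24 + l12 * l34) * (l14 * l23 + l13 * l24 + l12 * l34)) := by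
  simp [Matrix.det_succ_row_zero, Fin.sum_univ_succ, Fin.succAbove]
  ring
end

section
/- (Penner's theorem in the hyperbolic plane, Lorentzian form.) Let v₁, v₂, v₃, v₄ be lightlike vectors in Lorentzian space ℝ^{2,1} (so ℝ³ with form ⟨x,y⟩ = x₁y₁ + x₂y₂ − x₃y₃), each with positive last coordinate, and set λ_{ij} = √(−⟨v_i, v_j⟩) for 1 ≤ i < j ≤ 4 (these quantities are well defined since ⟨v_i,v_j⟩ ≤ 0). Then at least one of the following three equalities holds: λ₁₂λ₃₄ = λ₁₄λ₂₃ + λ₁₃λ₂₄, or λ₁₃λ₂₄ = λ₁₄λ₂₃ + λ₁₂λ₃₄, or λ₁₄λ₂₃ = λ₁₃λ₂₄ + λ₁₂λ₃₄. -/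
/-- A lightlike vector of `ℝ^{2,1}` with positive last coordinate is the square of a real spinor. -/
lemma exists_spinor_of_lorentz_self_eq_zero (x : Fin 3 → ℝ) (hx : lorentz x x = 0)
    (hpos : 0 < x (Fin.last 2)) :
    ∃ a b : ℝ, x 0 = 2 * a * b ∧ x 1 = a ^ 2 - b ^ 2 ∧ x 2 = a ^ 2 + b ^ 2 := by
  have hx' : x 0 * x 0 + x 1 * x 1 - x 2 * x 2 = 0 := by
    simpa [lorentz, Fin.sum_univ_two] using hx
  have hpos' : 0 < x 2 := hpos
  have hle : |x 1| ≤ x 2 := abs_le_of_sq_le_sq (by nlinarith [sq_nonneg (x 0)]) hpos'.le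
  obtain ⟨hlow, hup⟩ := abs_le.mp hle
  have ha := Real.sq_sqrt (show 0 ≤ (x 2 + x 1) / 2 by linarith)
  have hb := Real.sq_sqrt (show 0 ≤ (x 2 - x 1) / 2 by linarith)
  set a := √((x 2 + x 1) / 2)
  set b := √((x 2 - x 1) / 2)
  have hab : x 0 ^ 2 = (2 * a * b) ^ 2 := by
    rw [mul_pow, mul_pow, ha, hb]
    linear_combination hx'
  rcases sq_eq_sq_iff_eq_or_eq_neg.mp hab with h | h
  · exact ⟨a, b, h, by linarith, by linarith⟩
  · exact ⟨a, -b, by linarith, by rw [neg_sq]; linarith, by rw [neg_sq]; linarith⟩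

lemma neg_lorentz_of_spinor {x y : Fin 3 → ℝ} {a b c d : ℝ}
    (hx₀ : x 0 = 2 * a * b) (hx₁ : x 1 = a ^ 2 - b ^ 2) (hx₂ : x 2 = a ^ 2 + b ^ 2)
    (hy₀ : y 0 = 2 * c * d) (hy₁ : y 1 = c ^ 2 - d ^ 2) (hy₂ : y 2 = c ^ 2 + d ^ 2) :
    -lorentz x y = 2 * (a * d - b * c) ^ 2 := by
  have h : lorentz x y = x 0 * y 0 + x 1 * y 1 - x 2 * y 2 := by
    simp [lorentz, Fin.sum_univ_two]
  rw [h, hx₀, hx₁, hx₂, hy₀, hy₁, hy₂]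
  ring

lemma abs_add_trichotomy {p q r : ℝ} (h : p - q + r = 0) :
    |p| = |r| + |q| ∨ |q| = |r| + |p| ∨ |r| = |q| + |p| := by
  grind

/-- Penner's theorem in the hyperbolic plane: for lightlike vectors
`v₁, v₂, v₃, v₄` in `ℝ^{2,1}` with positive last coordinate, setting
`λ_{ij} = √(−⟨v_i, v_j⟩)`, one of the three Ptolemy-type equalities holds. -/
theorem stmt6 (v : Fin 4 → (Fin 3 → ℝ))
    (hlight : ∀ i, lorentz (v i) (v i) = 0)
    (hpos : ∀ i, 0 < v i (Fin.last 2))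
    (lam : Fin 4 → Fin 4 → ℝ)
    (hlam : ∀ i j, lam i j = Real.sqrt (-(lorentz (v i) (v j)))) :
    lam 0 1 * lam 2 3 = lam 0 3 * lam 1 2 + lam 0 2 * lam 1 3 ∨
    lam 0 2 * lam 1 3 = lam 0 3 * lam 1 2 + lam 0 1 * lam 2 3 ∨
    lam 0 3 * lam 1 2 = lam 0 2 * lam 1 3 + lam 0 1 * lam 2 3 := by
  choose a b h₀ h₁ h₂ using fun i => exists_spinor_of_lorentz_self_eq_zero (v i) (hlight i) (hpos i)
  have hl : ∀ i j, lam i j = √2 * |a i * b j - b i * a j| := by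
    intro i j
    rw [hlam, neg_lorentz_of_spinor (h₀ i) (h₁ i) (h₂ i) (h₀ j) (h₁ j) (h₂ j),
      Real.sqrt_mul (by norm_num), Real.sqrt_sq_eq_abs]
  have hmul : ∀ i j k l, lam i j * lam k l =
      2 * |(a i * b j - b i * a j) * (a k * b l - b k * a l)| := by
    intro i j k l
    rw [hl, hl, abs_mul, mul_mul_mul_comm, Real.mul_self_sqrt (by norm_num)]
  have hrel : (a 0 * b 1 - b 0 * a 1) * (a 2 * b 3 - b 2 * a 3) -
      (a 0 * b 2 - b 0 * a 2) * (a 1 * b 3 - b 1 * a 3) +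
      (a 0 * b 3 - b 0 * a 3) * (a 1 * b 2 - b 1 * a 2) = 0 := by ring
  simp only [hmul]
  have := abs_add_trichotomy hrel
  grind
end

section
/- (Ptolemy's theorem in the Euclidean plane with full converse.) Let v₁, v₂, v₃, v₄ be points in the Euclidean plane ℝ² and write d_{ij} for the Euclidean distance between v_i and v_j. Then v₁, v₂, v₃, v₄ lie on a common circle or on a common line if and only if at least one of the following three equalities holds: d₁₂d₃₄ = d₁₄d₂₃ + d₁₃d₂₄, or d₁₃d₂₄ = d₁₄d₂₃ + d₁₂d₃₄, or d₁₄d₂₃ = d₁₃d₂₄ + d₁₂d₃₄. -/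
/-- The matrix whose kernel describes the circles and lines through the points `v i`. -/
noncomputable def circleMatrix (v : Fin 4 → EuclideanSpace ℝ (Fin 2)) :
    Matrix (Fin 4) (Fin 4) ℝ :=
  Matrix.of fun i => ![v i 0 ^ 2 + v i 1 ^ 2, v i 0, v i 1, 1]

lemma dist_sq_eq_coord (p q : EuclideanSpace ℝ (Fin 2)) :
    dist p q ^ 2 = (p 0 - q 0) ^ 2 + (p 1 - q 1) ^ 2 := by
  rw [EuclideanSpace.dist_eq, Real.sq_sqrt (by positivity)]
  simp [Fin.sum_univ_two, Real.dist_eq, sq_abs]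

/-- The determinant vanishes iff the points satisfy a common nontrivial equation
`a * (x ^ 2 + y ^ 2) + b * x + c * y + e = 0`. -/
lemma circleMatrix_det_eq_zero_iff (v : Fin 4 → EuclideanSpace ℝ (Fin 2)) :
    (circleMatrix v).det = 0 ↔ ∃ a b c e : ℝ, (a ≠ 0 ∨ b ≠ 0 ∨ c ≠ 0) ∧
      ∀ i, a * (v i 0 ^ 2 + v i 1 ^ 2) + b * v i 0 + c * v i 1 + e = 0 := by
  rw [← Matrix.exists_mulVec_eq_zero_iff]
  constructor
  · rintro ⟨w, hw, h⟩
    have key : ∀ i, w 0 * (v i 0 ^ 2 + v i 1 ^ 2) + w 1 * v i 0 + w 2 * v i 1 + w 3 = 0 := by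
      intro i
      have := congrFun h i
      simp [circleMatrix, Matrix.mulVec, dotProduct, Fin.sum_univ_four] at this
      linarith
    refine ⟨w 0, w 1, w 2, w 3, ?_, key⟩
    by_contra! h0
    obtain ⟨h0, h1, h2⟩ := h0
    have h3 := key 0
    simp only [h0, h1, h2, zero_mul, zero_add] at h3
    exact hw (by ext i; fin_cases i <;> simp [h0, h1, h2, h3])
  · rintro ⟨a, b, c, e, hne, h⟩
    refine ⟨![a, b, c, e], ?_, ?_⟩
    · intro h0
      have ha := congrFun h0 0
      have hb := congrFun h0 1
      have hc := congrFun h0 2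
      simp at ha hb hc
      simp [ha, hb, hc] at hne
    · ext i
      have := h i
      simp [circleMatrix, Matrix.mulVec, dotProduct, Fin.sum_univ_four]
      linarith

lemma exists_circle_or_collinear_iff (v : Fin 4 → EuclideanSpace ℝ (Fin 2)) :
    ((∃ (c : EuclideanSpace ℝ (Fin 2)) (r : ℝ), 0 < r ∧ ∀ i, dist (v i) c = r) ∨
      Collinear ℝ (Set.range v)) ↔ (circleMatrix v).det = 0 := by
  rw [circleMatrix_det_eq_zero_iff]
  constructor
  · rintro (⟨c, r, -, h⟩ | h)
    · refine ⟨1, -2 * c 0, -2 * c 1, c 0 ^ 2 + c 1 ^ 2 - r ^ 2, by simp, fun i => ?_⟩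
      have := dist_sq_eq_coord (v i) c
      rw [h i] at this
      linarith
    · obtain ⟨p, u, h⟩ := (collinear_iff_exists_forall_eq_smul_vadd _).1 h
      by_cases hu : u 0 = 0 ∧ u 1 = 0
      · refine ⟨0, 1, 0, -p 0, by simp, fun i => ?_⟩
        obtain ⟨t, ht⟩ := h (v i) ⟨i, rfl⟩
        simp [ht, hu.1]
      · refine ⟨0, u 1, -u 0, u 0 * p 1 - u 1 * p 0, ?_, fun i => ?_⟩
        · simp only [ne_eq, neg_eq_zero]
          tauto
        · obtain ⟨t, ht⟩ := h (v i) ⟨i, rfl⟩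
          simp [ht]
          ring
  · rintro ⟨a, b, c, e, hne, h⟩
    by_cases ha : a = 0
    · subst ha
      right
      have hpos : b ^ 2 + c ^ 2 ≠ 0 := by
        intro h0
        have hb : b = 0 := by nlinarith [sq_nonneg b, sq_nonneg c]
        have hc : c = 0 := by nlinarith [sq_nonneg b, sq_nonneg c]
        simp [hb, hc] at hne
      rw [collinear_iff_exists_forall_eq_smul_vadd]
      refine ⟨v 0, !₂[-c, b], ?_⟩
      rintro _ ⟨i, rfl⟩
      refine ⟨(b * (v i 1 - v 0 1) - c * (v i 0 - v 0 0)) / (b ^ 2 + c ^ 2), ?_⟩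
      have h0 := h 0
      have hi := h i
      ext j
      fin_cases j
      · simp
        field_simp
        linear_combination b * hi - b * h0
      · simp
        field_simp
        linear_combination c * hi - c * h0
    · set o : EuclideanSpace ℝ (Fin 2) := !₂[-b / (2 * a), -c / (2 * a)] with ho
      have hd : ∀ i, dist (v i) o = dist (v 0) o := by
        intro i
        rw [← sq_eq_sq₀ dist_nonneg dist_nonneg, dist_sq_eq_coord, dist_sq_eq_coord]
        have h0 := h 0
        have hi := h i
        simp [ho]
        field_simp
        linear_combination 4 * a * hi - 4 * a * h0
      rcases (dist_nonneg (x := v 0) (y := o)).eq_or_lt with h0 | h0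
      · right
        have : Set.range v ⊆ {o} := by
          rintro _ ⟨i, rfl⟩
          exact dist_eq_zero.1 ((hd i).trans h0.symm)
        exact (collinear_singleton ℝ o).subset this
      · exact Or.inl ⟨o, _, h0, hd⟩

/-- Heron's expression in the three products of opposite distances is a multiple of the square of
the determinant. -/
lemma heron_mul_dist_eq_det_sq (v : Fin 4 → EuclideanSpace ℝ (Fin 2)) {A B C : ℝ}
    (hA : A = dist (v 0) (v 1) * dist (v 2) (v 3))
    (hB : B = dist (v 0) (v 2) * dist (v 1) (v 3))
    (hC : C = dist (v 0) (v 3) * dist (v 1) (v 2)) :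
    (A + B + C) * ((A - (C + B)) * ((B - (C + A)) * (C - (B + A)))) =
      -4 * (circleMatrix v).det ^ 2 := by
  have expand : (A + B + C) * ((A - (C + B)) * ((B - (C + A)) * (C - (B + A)))) =
      (A ^ 2) ^ 2 + (B ^ 2) ^ 2 + (C ^ 2) ^ 2 -
        2 * (A ^ 2 * B ^ 2 + B ^ 2 * C ^ 2 + C ^ 2 * A ^ 2) := by ring
  rw [expand, hA, hB, hC]
  simp only [mul_pow, dist_sq_eq_coord]
  simp [circleMatrix, Matrix.det_succ_row_zero, Fin.sum_univ_succ, Fin.succAbove]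
  ring


/-- Ptolemy's theorem in the Euclidean plane with full converse:
four points of the Euclidean plane lie on a common circle or a common line iff
one of the three Ptolemy equalities between the six pairwise distances holds. -/
theorem stmt7 (v : Fin 4 → EuclideanSpace ℝ (Fin 2))
    (d : Fin 4 → Fin 4 → ℝ) (hd : ∀ i j, d i j = dist (v i) (v j)) :
    ((∃ (c : EuclideanSpace ℝ (Fin 2)) (r : ℝ), 0 < r ∧ ∀ i, dist (v i) c = r) ∨
      Collinear ℝ (Set.range v)) ↔
      (d 0 1 * d 2 3 = d 0 3 * d 1 2 + d 0 2 * d 1 3 ∨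
       d 0 2 * d 1 3 = d 0 3 * d 1 2 + d 0 1 * d 2 3 ∨
       d 0 3 * d 1 2 = d 0 2 * d 1 3 + d 0 1 * d 2 3) := by
  rw [exists_circle_or_collinear_iff]
  have key := heron_mul_dist_eq_det_sq v rfl rfl rfl
  simp only [← hd] at key
  have hA : 0 ≤ d 0 1 * d 2 3 := by simp only [hd]; positivity
  have hB : 0 ≤ d 0 2 * d 1 3 := by simp only [hd]; positivity
  have hC : 0 ≤ d 0 3 * d 1 2 := by simp only [hd]; positivity
  rw [← sub_eq_zero (a := d 0 1 * d 2 3), ← sub_eq_zero (a := d 0 2 * d 1 3),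
    ← sub_eq_zero (a := d 0 3 * d 1 2), ← mul_eq_zero, ← mul_eq_zero]
  constructor
  · intro h
    rw [h] at key
    rcases mul_eq_zero.1 (key.trans (by norm_num)) with h0 | h0
    · have : d 0 1 * d 2 3 - (d 0 3 * d 1 2 + d 0 2 * d 1 3) = 0 := by linarith
      rw [this, zero_mul]
    · exact h0
  · intro h
    rw [h, mul_zero] at key
    exact pow_eq_zero_iff two_ne_zero |>.1 (by linarith)
end

section
/- (Ptolemy's theorem 1, Lorentzian form.) Let n ≥ 2 and let v₁, …, v_{n+1} be vectors in Lorentzian space ℝ^{n,1} with ‖v_i‖² = −1 and positive last coordinate (points of hyperbolic space). Suppose there exists u ∈ ℝ^{n+1} with ‖u‖² ≠ 1, ‖u‖² ≠ −1, and ⟨v_i, u⟩ = ½(‖u‖² − 1) for all i (this holds when the points lie on a common horosphere or hypersphere). Let B be the (n+1)×(n+1) matrix with entries B_{ij} = −½(⟨v_i, v_j⟩ + 1). Then there exists a spacelike vector w with ⟨v_i, w⟩ = 0 for all i (i.e. the points lie on a common hyperplane) if and only if det B = 0. -/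
open Matrix in
/-- The Gram matrix of the Lorentzian form in the standard basis. -/
def lorentzGram (n : ℕ) : Matrix (Fin (n + 1)) (Fin (n + 1)) ℝ :=
  Matrix.diagonal fun i => if i = Fin.last n then -1 else 1

open Matrix in
theorem lorentz_eq_dotProduct {n : ℕ} (x y : Fin (n + 1) → ℝ) :
    lorentz x y = x ⬝ᵥ (lorentzGram n *ᵥ y) := by
  simp [lorentz, lorentzGram, dotProduct, Matrix.mulVec_diagonal, Fin.sum_univ_castSucc,
    Fin.castSucc_ne_last, sub_eq_add_neg]

theorem lorentzGram_det_ne_zero (n : ℕ) : (lorentzGram n).det ≠ 0 := by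
  rw [lorentzGram, Matrix.det_diagonal, Finset.prod_ne_zero_iff]
  intro i _
  split_ifs <;> norm_num

/-- A nonzero vector orthogonal to a timelike vector is spacelike. -/
theorem lorentz_self_pos_of_orthogonal {n : ℕ} {v w : Fin (n + 1) → ℝ}
    (hv : lorentz v v < 0) (hvw : lorentz v w = 0) (hw : w ≠ 0) : 0 < lorentz w w := by
  have cs := Finset.sum_mul_sq_le_sq_mul_sq Finset.univ
    (fun i : Fin n => v i.castSucc) (fun i => w i.castSucc)
  simp only [lorentz, ← pow_two] at *
  rw [sub_eq_zero.1 hvw] at cs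
  set a := ∑ i : Fin n, v i.castSucc ^ 2
  set W := ∑ i : Fin n, w i.castSucc ^ 2 with hW
  have ha : 0 ≤ a := Finset.sum_nonneg fun i _ => sq_nonneg _
  have hW0 : 0 ≤ W := Finset.sum_nonneg fun i _ => sq_nonneg _
  have hv' : a < v (Fin.last n) ^ 2 := by linarith
  rw [mul_pow] at cs
  rcases hW0.eq_or_lt with h | h
  · refine absurd ?_ hw
    have hlast : w (Fin.last n) = 0 := by
      rw [← h, mul_zero] at cs
      by_contra hne
      have : 0 < w (Fin.last n) ^ 2 := by positivity
      nlinarith [mul_pos (ha.trans_lt hv') this]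
    have hz := (Finset.sum_eq_zero_iff_of_nonneg fun i _ => sq_nonneg _).1 (hW.symm.trans h.symm)
    funext i
    refine Fin.lastCases hlast (fun i => ?_) i
    simpa using hz i (Finset.mem_univ i)
  · have h1 : a * W < v (Fin.last n) ^ 2 * W := mul_lt_mul_of_pos_right hv' h
    have := lt_of_mul_lt_mul_left (cs.trans_lt h1) (sq_nonneg _)
    linarith

open Matrix in
/-- Points of the unit hyperboloid lie on a common hyperplane iff their coordinate matrix is
singular. -/
theorem exists_spacelike_orthogonal_iff_det_eq_zero {n : ℕ} (v : Fin (n + 1) → Fin (n + 1) → ℝ)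
    (hv : ∀ i, lorentz (v i) (v i) = -1) :
    (∃ w : Fin (n + 1) → ℝ, 0 < lorentz w w ∧ ∀ i, lorentz (v i) w = 0) ↔
      (Matrix.of v).det = 0 := by
  have key : (Matrix.of v).det = 0 ↔ ∃ w ≠ 0, (Matrix.of v * lorentzGram n) *ᵥ w = 0 := by
    rw [Matrix.exists_mulVec_eq_zero_iff, Matrix.det_mul, mul_eq_zero,
      or_iff_left (lorentzGram_det_ne_zero n)]
  have entry (w) (i) : ((Matrix.of v * lorentzGram n) *ᵥ w) i = lorentz (v i) w := by
    rw [← Matrix.mulVec_mulVec, lorentz_eq_dotProduct]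
    rfl
  rw [key]
  constructor
  · rintro ⟨w, hw, h⟩
    refine ⟨w, ?_, funext fun i => (entry w i).trans (h i)⟩
    rintro rfl
    simp [lorentz] at hw
  · rintro ⟨w, hw, h⟩
    have h' (i) : lorentz (v i) w = 0 := (entry w i).symm.trans (congrFun h i)
    exact ⟨w, lorentz_self_pos_of_orthogonal (by rw [hv 0]; norm_num) (h' 0) hw, h'⟩

open Matrix in
/-- If `⟨v i, u⟩ = c ≠ 0` for all `i`, the matrix `⟨v i, v j⟩ + 1` is congruent to a rank-one
perturbation of the Lorentzian Gram matrix. -/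
theorem det_lorentz_add_one {n : ℕ} (v : Fin (n + 1) → Fin (n + 1) → ℝ)
    (u : Fin (n + 1) → ℝ) {c : ℝ} (hc : c ≠ 0) (hu : ∀ i, lorentz (v i) u = c) :
    (Matrix.of fun i j => lorentz (v i) (v j) + 1).det =
      (Matrix.of v).det * (lorentzGram n).det * (1 + lorentz u u / c ^ 2) * (Matrix.of v).det := by
  set b : Fin (n + 1) → ℝ := (c ^ 2)⁻¹ • (lorentzGram n *ᵥ u) with hb
  have hVu : (Matrix.of v * lorentzGram n) *ᵥ u = fun _ => c := by
    funext i
    rw [← Matrix.mulVec_mulVec, ← hu i, lorentz_eq_dotProduct]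
    rfl
  have hVb : b ᵥ* (Matrix.of v)ᵀ = fun _ => c⁻¹ := by
    funext i
    rw [Matrix.vecMul_transpose, hb, Matrix.mulVec_smul]
    change (c ^ 2)⁻¹ * (v i ⬝ᵥ (lorentzGram n *ᵥ u)) = c⁻¹
    rw [← lorentz_eq_dotProduct, hu i]
    field_simp
  have hfac : (Matrix.of fun i j => lorentz (v i) (v j) + 1) =
      Matrix.of v * lorentzGram n * (1 + vecMulVec u b) * (Matrix.of v)ᵀ := by
    rw [mul_add, mul_one, add_mul, Matrix.mul_vecMulVec, Matrix.vecMulVec_mul, hVu, hVb]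
    ext i j
    rw [Matrix.add_apply, vecMulVec_apply, mul_inv_cancel₀ hc, Matrix.of_apply,
      lorentz_eq_dotProduct, Matrix.mul_assoc]
    congr 1
  have hdet : (1 + vecMulVec u b).det = 1 + lorentz u u / c ^ 2 := by
    rw [Matrix.vecMulVec_eq Unit, Matrix.det_one_add_replicateCol_mul_replicateRow, hb,
      smul_dotProduct, dotProduct_comm, ← lorentz_eq_dotProduct, smul_eq_mul, div_eq_inv_mul]
  rw [hfac, Matrix.det_mul, Matrix.det_mul, Matrix.det_mul, Matrix.det_transpose, hdet]

/-- Ptolemy's theorem 1, Lorentzian form: for points `v₁, …, v_{n+1}` of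
hyperbolic space lying on a common horosphere or hypersphere (witnessed by `u`), the
points lie on a common hyperplane iff `det B = 0`, where `B_{ij} = −½(⟨v_i,v_j⟩ + 1)`. -/
theorem stmt8 (n : ℕ) (hn : 2 ≤ n) (v : Fin (n + 1) → (Fin (n + 1) → ℝ))
    (hv : ∀ i, lorentz (v i) (v i) = -1)
    (hpos : ∀ i, 0 < v i (Fin.last n))
    (u : Fin (n + 1) → ℝ) (hu1 : lorentz u u ≠ 1) (hu2 : lorentz u u ≠ -1)
    (hu : ∀ i, lorentz (v i) u = (lorentz u u - 1) / 2) :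
    (∃ w : Fin (n + 1) → ℝ, 0 < lorentz w w ∧ ∀ i, lorentz (v i) w = 0) ↔
      Matrix.det (Matrix.of fun i j : Fin (n + 1) =>
        -(lorentz (v i) (v j) + 1) / 2) = 0 := by
  rw [exists_spacelike_orthogonal_iff_det_eq_zero v hv]
  have hc : (lorentz u u - 1) / 2 ≠ 0 := div_ne_zero (sub_ne_zero.2 hu1) two_ne_zero
  have hs : 1 + lorentz u u / ((lorentz u u - 1) / 2) ^ 2 ≠ 0 := by
    have h1 := sub_ne_zero.2 hu1
    have h2 : lorentz u u + 1 ≠ 0 := fun h => hu2 (eq_neg_of_add_eq_zero_left h)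
    have : 1 + lorentz u u / ((lorentz u u - 1) / 2) ^ 2 =
        ((lorentz u u + 1) / (lorentz u u - 1)) ^ 2 := by
      field_simp
      ring
    rw [this]
    exact pow_ne_zero 2 (div_ne_zero h2 h1)
  have hB : (Matrix.of fun i j : Fin (n + 1) => -(lorentz (v i) (v j) + 1) / 2) =
      (-1 / 2 : ℝ) • Matrix.of fun i j => lorentz (v i) (v j) + 1 := by
    ext i j
    simp only [Matrix.of_apply, Matrix.smul_apply, smul_eq_mul]
    ring
  rw [hB, Matrix.det_smul, det_lorentz_add_one v u hc hu]
  simp [hs, lorentzGram_det_ne_zero]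
end

section
/- (Casey's theorem, Lorentzian form.) Let n ≥ 2 and let v₁, …, v_{n+1} be spacelike vectors in Lorentzian space ℝ^{n,1} with ‖v_i‖² = 1 (unit normals to hyperplanes in hyperbolic space). Then there exist signs ε₁, …, ε_{n+1} ∈ {1, −1} such that det C = 0, where C is the (n+1)×(n+1) matrix with entries C_{ij} = ½(ε_i ε_j ⟨v_i, v_j⟩ − 1), if and only if at least one of the following holds: (i) there exists a vector v with ‖v‖² = 1 and |⟨v_i, v⟩| = 1 for all i; (ii) there exists a nonzero lightlike vector w with ⟨v_i, w⟩ = 0 for all i; (iii) there exist linearly independent vectors u, v with ‖u‖² = ‖v‖² = 1 and a real number λ with 0 ≤ λ < 1 such that ⟨v_i, u⟩ = 0 and |⟨v_i, v⟩| = λ for all i. -/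
namespace Casey

open Module

section Gram

variable {K V ι : Type*} [Field K] [AddCommGroup V] [Module K V]

lemma mem_orthogonal_span_range_iff (b : LinearMap.BilinForm K V) (f : ι → V) (x : V) :
    x ∈ b.orthogonal (Submodule.span K (Set.range f)) ↔ ∀ i, b (f i) x = 0 := by
  rw [LinearMap.BilinForm.mem_orthogonal_iff]
  refine ⟨fun h i => h _ (Submodule.subset_span ⟨i, rfl⟩), fun h y hy => ?_⟩
  change b y x = 0
  induction hy using Submodule.span_induction with
  | mem y hy => obtain ⟨i, rfl⟩ := hy; exact h i
  | zero => simp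
  | add y z _ _ hy hz => simp [hy, hz]
  | smul a y _ hy => simp [hy]

variable [Fintype ι]

lemma gram_mulVec (b : LinearMap.BilinForm K V) (f : ι → V) (c : ι → K) (i : ι) :
    ((Matrix.of fun i j => b (f i) (f j)).mulVec c) i = b (f i) (∑ j, c j • f j) := by
  simp [Matrix.mulVec, dotProduct, mul_comm]

variable [FiniteDimensional K V]

lemma not_linearIndependent_iff_one_lt_finrank_orthogonal {b : LinearMap.BilinForm K V}
    (hb : b.Nondegenerate) (f : ι → V) (hd : finrank K V = Fintype.card ι + 1) :
    ¬ LinearIndependent K f ↔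
      1 < finrank K (b.orthogonal (Submodule.span K (Set.range f))) := by
  rw [linearIndependent_iff_card_le_finrank_span, b.finrank_orthogonal hb, Set.finrank, hd]
  omega

/-- If the number of vectors is one less than the dimension of the space, their Gram determinant
vanishes iff they are dependent or some nonzero isotropic vector is orthogonal to all of them. -/
lemma gram_det_eq_zero_iff [DecidableEq ι] {b : LinearMap.BilinForm K V}
    (hb : b.Nondegenerate) (hr : b.IsRefl) (f : ι → V) (hd : finrank K V = Fintype.card ι + 1) :
    (Matrix.of fun i j => b (f i) (f j)).det = 0 ↔
      ¬ LinearIndependent K f ∨ ∃ x, x ≠ 0 ∧ b x x = 0 ∧ ∀ i, b (f i) x = 0 := by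
  rw [← Matrix.exists_mulVec_eq_zero_iff]
  constructor
  · rintro ⟨c, hc, h⟩
    rw [or_iff_not_imp_left, not_not]
    intro hf
    have hx : ∀ i, b (f i) (∑ j, c j • f j) = 0 := fun i => by
      rw [← gram_mulVec, h, Pi.zero_apply]
    refine ⟨∑ j, c j • f j, fun h0 => hc ?_, ?_, hx⟩
    · exact funext (Fintype.linearIndependent_iff.1 hf c h0)
    · rw [LinearMap.map_sum₂]
      exact Finset.sum_eq_zero fun i _ => by
        rw [map_smul, LinearMap.smul_apply, hx, smul_zero]
  · intro h
    by_cases hf : LinearIndependent K f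
    · obtain ⟨x, hx0, hxx, hx⟩ := h.resolve_left (not_not.2 hf)
      set S := Submodule.span K (Set.range f) with hS
      have hxS : x ∈ b.orthogonal S := (mem_orthogonal_span_range_iff b f x).2 hx
      have hle : finrank K (b.orthogonal S) ≤ 1 := by
        by_contra h1
        exact (not_linearIndependent_iff_one_lt_finrank_orthogonal hb f hd).2 (not_le.1 h1) hf
      have hspan : b.orthogonal S ≤ Submodule.span K {x} := by
        refine (Submodule.eq_of_le_of_finrank_le ?_ ?_).ge
        · rwa [Submodule.span_singleton_le_iff_mem]
        · rwa [finrank_span_singleton hx0]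
      have hxS' : x ∈ S := by
        rw [← b.orthogonal_orthogonal hb hr S, LinearMap.BilinForm.mem_orthogonal_iff]
        intro y hy
        obtain ⟨a, rfl⟩ := Submodule.mem_span_singleton.1 (hspan hy)
        change b (a • x) x = 0
        simp [hxx]
      obtain ⟨c, hc⟩ := (Submodule.mem_span_range_iff_exists_fun K).1 hxS'
      refine ⟨c, ?_, ?_⟩
      · rintro rfl
        exact hx0 (by simp [← hc])
      · ext i
        rw [gram_mulVec, hc, hx, Pi.zero_apply]
    · obtain ⟨c, hc, i, hi⟩ := Fintype.not_linearIndependent_iff.1 hf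
      refine ⟨c, fun h0 => hi (congrFun h0 i), ?_⟩
      ext i
      rw [gram_mulVec, hc, map_zero, Pi.zero_apply]

end Gram

section Lorentz

variable {n : ℕ}

lemma lorentz_comm (x y : Fin (n + 1) → ℝ) : lorentz x y = lorentz y x := by
  simp [lorentz, mul_comm]

lemma lorentz_add_left (x y z : Fin (n + 1) → ℝ) :
    lorentz (x + y) z = lorentz x z + lorentz y z := by
  simp only [lorentz, Pi.add_apply, add_mul, Finset.sum_add_distrib]
  ring

lemma lorentz_smul_left (a : ℝ) (x y : Fin (n + 1) → ℝ) :
    lorentz (a • x) y = a * lorentz x y := by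
  simp only [lorentz, Pi.smul_apply, smul_eq_mul, mul_assoc, ← Finset.mul_sum, mul_sub]

lemma lorentz_add_right (x y z : Fin (n + 1) → ℝ) :
    lorentz x (y + z) = lorentz x y + lorentz x z := by
  rw [lorentz_comm, lorentz_add_left, lorentz_comm y, lorentz_comm z]

lemma lorentz_smul_right (a : ℝ) (x y : Fin (n + 1) → ℝ) :
    lorentz x (a • y) = a * lorentz x y := by
  rw [lorentz_comm, lorentz_smul_left, lorentz_comm y]

/-- The vectors orthogonal to a timelike vector are not timelike. -/
lemma lorentz_self_nonneg_of_orthogonal {u x : Fin (n + 1) → ℝ} (hu : lorentz u u < 0)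
    (hux : lorentz u x = 0) : 0 ≤ lorentz x x := by
  simp only [lorentz, ← pow_two] at *
  have hcs := Finset.sum_mul_sq_le_sq_mul_sq Finset.univ
    (fun i : Fin n => u i.castSucc) (fun i : Fin n => x i.castSucc)
  have hU : 0 ≤ ∑ i : Fin n, u i.castSucc ^ 2 := Finset.sum_nonneg fun i _ => sq_nonneg _
  have hX : 0 ≤ ∑ i : Fin n, x i.castSucc ^ 2 := Finset.sum_nonneg fun i _ => sq_nonneg _
  rw [sub_eq_zero.1 hux, mul_pow] at hcs
  by_contra! h
  have := mul_lt_mul'' (sub_neg.1 hu) (sub_neg.1 h) hU hX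
  linarith

/-- The form `⟨x, y⟩ - s t` on pairs `(x, s)`, `(y, t)`, of signature `(n, 2)`. -/
noncomputable def extendedForm (n : ℕ) : LinearMap.BilinForm ℝ ((Fin (n + 1) → ℝ) × ℝ) :=
  LinearMap.mk₂ ℝ (fun p q => lorentz p.1 q.1 - p.2 * q.2)
    (fun p q r => by simp only [Prod.fst_add, Prod.snd_add, lorentz_add_left]; ring)
    (fun a p q => by
      simp only [Prod.smul_fst, Prod.smul_snd, lorentz_smul_left, smul_eq_mul]; ring)
    (fun p q r => by simp only [Prod.fst_add, Prod.snd_add, lorentz_add_right]; ring)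
    (fun a p q => by
      simp only [Prod.smul_fst, Prod.smul_snd, lorentz_smul_right, smul_eq_mul]; ring)

lemma extendedForm_apply (p q : (Fin (n + 1) → ℝ) × ℝ) :
    extendedForm n p q = lorentz p.1 q.1 - p.2 * q.2 := rfl

lemma extendedForm_comm (p q : (Fin (n + 1) → ℝ) × ℝ) :
    extendedForm n p q = extendedForm n q p := by
  rw [extendedForm_apply, extendedForm_apply, lorentz_comm, mul_comm]

lemma extendedForm_isRefl (n : ℕ) : (extendedForm n).IsRefl := fun p q h => by
  rw [extendedForm_comm, h]

lemma extendedForm_nondegenerate (n : ℕ) : (extendedForm n).Nondegenerate := by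
  have key : ∀ p, (∀ q, extendedForm n p q = 0) → p = 0 := by
    rintro ⟨x, t⟩ h
    have h1 := h (Fin.snoc (fun i => x i.castSucc) (-x (Fin.last n)), -t)
    simp only [extendedForm_apply, lorentz, Fin.snoc_castSucc, Fin.snoc_last] at h1
    have hs : 0 ≤ ∑ i : Fin n, x i.castSucc * x i.castSucc :=
      Finset.sum_nonneg fun i _ => mul_self_nonneg _
    have ht : t = 0 := by nlinarith [mul_self_nonneg (x (Fin.last n)), mul_self_nonneg t]
    have hl : x (Fin.last n) = 0 := by
      nlinarith [mul_self_nonneg (x (Fin.last n)), mul_self_nonneg t]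
    have hz : ∑ i : Fin n, x i.castSucc * x i.castSucc = 0 := by simpa [ht, hl] using h1
    rw [Finset.sum_eq_zero_iff_of_nonneg fun i _ => mul_self_nonneg _] at hz
    refine Prod.ext (funext fun i => ?_) ht
    refine Fin.lastCases hl (fun i => ?_) i
    exact mul_self_eq_zero.1 (hz i (Finset.mem_univ i))
  exact ⟨key, fun q h => key q fun p => by rw [extendedForm_comm, h p]⟩

/-- If a form takes values of opposite sign on orthogonal vectors `u` and `z`, some `z + s • u` is
isotropic. -/
lemma exists_extendedForm_self_eq_zero {u z : (Fin (n + 1) → ℝ) × ℝ}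
    (hu : extendedForm n u u ≠ 0) (huz : extendedForm n u z = 0)
    (h : extendedForm n z z / extendedForm n u u ≤ 0) :
    ∃ s : ℝ, extendedForm n (z + s • u) (z + s • u) = 0 := by
  refine ⟨√(-(extendedForm n z z / extendedForm n u u)), ?_⟩
  have hs := Real.mul_self_sqrt (neg_nonneg.2 h)
  have hzu : extendedForm n z u = 0 := by rw [extendedForm_comm, huz]
  simp only [map_add, LinearMap.add_apply, map_smul, LinearMap.smul_apply, smul_eq_mul, huz, hzu]
  rw [mul_zero, add_zero, zero_add, ← mul_assoc, hs, neg_mul, div_mul_cancel₀ _ hu, add_neg_cancel]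

/-- Vectors at a common signed inclination to the unit spacelike vectors `w i`: a two-dimensional
family of pairs `(y, t)` with `⟨w i, y⟩ = t` contains a nonzero isotropic one, or an orthonormal
pair as in the third case of Casey's theorem. -/
lemma exists_isotropic_or_exists_orthogonal_pair {ι : Type*} [Nonempty ι]
    {w : ι → Fin (n + 1) → ℝ} (hw : ∀ i, lorentz (w i) (w i) = 1)
    {p q : (Fin (n + 1) → ℝ) × ℝ} (hpq : LinearIndependent ℝ ![p, q])
    (hp : ∀ i, lorentz (w i) p.1 = p.2) (hq : ∀ i, lorentz (w i) q.1 = q.2) :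
    (∃ x : (Fin (n + 1) → ℝ) × ℝ, x ≠ 0 ∧ extendedForm n x x = 0 ∧
      ∀ i, lorentz (w i) x.1 = x.2) ∨
    ∃ (u y : Fin (n + 1) → ℝ) (lam : ℝ), LinearIndependent ℝ ![u, y] ∧
      lorentz u u = 1 ∧ lorentz y y = 1 ∧ 0 ≤ lam ∧ lam < 1 ∧
      ∀ i, lorentz (w i) u = 0 ∧ |lorentz (w i) y| = lam := by
  rw [LinearIndependent.pair_iff] at hpq
  obtain ⟨u, z, hu0, hz0, hu, hz⟩ : ∃ (u : Fin (n + 1) → ℝ) (z : (Fin (n + 1) → ℝ) × ℝ),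
      u ≠ 0 ∧ (∀ s : ℝ, z + s • (u, (0 : ℝ)) ≠ 0) ∧ (∀ i, lorentz (w i) u = 0) ∧
      ∀ i, lorentz (w i) z.1 = z.2 := by
    by_cases ht : p.2 = 0
    · have hpe : p = (p.1, 0) := Prod.ext rfl ht
      refine ⟨p.1, q, fun h => ?_, fun s h => ?_, fun i => by rw [hp, ht], hq⟩
      · have := (hpq 1 0 (by rw [hpe, h]; simp)).1
        norm_num at this
      · rw [← hpe] at h
        have := (hpq s 1 (by rw [← h, one_smul, add_comm q])).2
        norm_num at this
    · have hue : (((q.2 • p + (-p.2) • q).1, 0) : (Fin (n + 1) → ℝ) × ℝ) =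
          q.2 • p + (-p.2) • q := by
        refine Prod.ext rfl ?_
        simp only [Prod.snd_add, Prod.smul_snd, smul_eq_mul]
        ring
      refine ⟨(q.2 • p + (-p.2) • q).1, p, fun h => ?_, fun s h => ?_, fun i => ?_, hp⟩
      · rw [h] at hue
        exact ht (neg_eq_zero.1 (hpq q.2 (-p.2) hue.symm).2)
      · rw [hue] at h
        have h2 := hpq (1 + s * q.2) (s * -p.2) (by rw [← h]; module)
        have hs : s = 0 := by simpa [ht] using h2.2
        simp [hs] at h2
      · simp only [Prod.fst_add, Prod.smul_fst, lorentz_add_right, lorentz_smul_right, hp, hq]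
        ring
  by_cases huu : lorentz u u = 0
  · exact .inl ⟨(u, 0), fun h => hu0 (congrArg Prod.fst h), by simp [extendedForm_apply, huu], hu⟩
  rw [or_iff_not_imp_left]
  intro hiso
  obtain ⟨y, t, hyt0, huy, hy⟩ : ∃ (y : Fin (n + 1) → ℝ) (t : ℝ),
      (∀ s : ℝ, (y, t) + s • (u, (0 : ℝ)) ≠ 0) ∧ lorentz u y = 0 ∧
      ∀ i, lorentz (w i) y = t := by
    refine ⟨z.1 + (-(lorentz u z.1 / lorentz u u)) • u, z.2, fun s h => ?_, ?_, fun i => ?_⟩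
    · refine hz0 (-(lorentz u z.1 / lorentz u u) + s) ?_
      rw [← h]
      refine Prod.ext ?_ ?_
      · simp only [Prod.fst_add, Prod.smul_fst]
        module
      · simp
    · rw [lorentz_add_right, lorentz_smul_right]
      field_simp
      ring
    · rw [lorentz_add_right, lorentz_smul_right, hu, hz, mul_zero, add_zero]
  have hsign : 0 < (lorentz y y - t * t) / lorentz u u := by
    by_contra! hle
    have hu' : extendedForm n (u, 0) (u, 0) = lorentz u u := by simp [extendedForm_apply]
    obtain ⟨s, hs⟩ := exists_extendedForm_self_eq_zero (u := (u, 0)) (z := (y, t))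
      (by rwa [hu']) (by simp [extendedForm_apply, huy]) (by rw [hu']; exact hle)
    refine hiso ⟨_, hyt0 s, hs, fun i => ?_⟩
    simp [lorentz_add_right, lorentz_smul_right, hy, hu]
  rcases lt_or_gt_of_ne huu with hneg | hpos
  · exfalso
    obtain ⟨i⟩ := ‹Nonempty ι›
    have h1 := lorentz_self_nonneg_of_orthogonal (x := y + (-t) • w i) hneg (by
      rw [lorentz_add_right, lorentz_smul_right, huy, lorentz_comm, hu]; ring)
    simp only [lorentz_add_right, lorentz_add_left, lorentz_smul_left, lorentz_smul_right,
      hw, hy, lorentz_comm y] at h1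
    have h2 := (div_pos_iff.1 hsign).resolve_left fun h => hneg.not_gt h.2
    linarith [h2.1]
  · have h2 := (div_pos_iff_of_pos_right hpos).1 hsign
    have hyy : 0 < lorentz y y := by nlinarith [mul_self_nonneg t]
    have hsq : √(lorentz y y) * √(lorentz y y) = lorentz y y := Real.mul_self_sqrt hyy.le
    have hsu : √(lorentz u u) * √(lorentz u u) = lorentz u u := Real.mul_self_sqrt hpos.le
    have hy0 : 0 < √(lorentz y y) := Real.sqrt_pos.2 hyy
    have hu0 : 0 < √(lorentz u u) := Real.sqrt_pos.2 hpos
    have hu1 : lorentz ((√(lorentz u u))⁻¹ • u) ((√(lorentz u u))⁻¹ • u) = 1 := by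
      rw [lorentz_smul_left, lorentz_smul_right]
      field_simp
      linarith
    have hy1 : lorentz ((√(lorentz y y))⁻¹ • y) ((√(lorentz y y))⁻¹ • y) = 1 := by
      rw [lorentz_smul_left, lorentz_smul_right]
      field_simp
      linarith
    have huy1 : lorentz ((√(lorentz u u))⁻¹ • u) ((√(lorentz y y))⁻¹ • y) = 0 := by
      rw [lorentz_smul_left, lorentz_smul_right, huy, mul_zero, mul_zero]
    refine ⟨(√(lorentz u u))⁻¹ • u, (√(lorentz y y))⁻¹ • y, |t| / √(lorentz y y), ?_, hu1, hy1,
      by positivity, ?_, fun i => ⟨?_, ?_⟩⟩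
    · rw [LinearIndependent.pair_iff]
      intro a c hac
      have e1 := congrArg (lorentz ((√(lorentz u u))⁻¹ • u)) hac
      have e2 := congrArg (lorentz ((√(lorentz y y))⁻¹ • y)) hac
      rw [lorentz_add_right, lorentz_smul_right _ _ (_ • u), lorentz_smul_right _ _ (_ • y),
        hu1, huy1] at e1
      rw [lorentz_add_right, lorentz_smul_right _ _ (_ • u), lorentz_smul_right _ _ (_ • y),
        hy1, lorentz_comm, huy1] at e2
      simp only [mul_one, mul_zero, add_zero, zero_add] at e1 e2
      simpa [lorentz] using And.intro e1 e2
    · rw [div_lt_one hy0]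
      exact abs_lt_of_sq_lt_sq (by nlinarith) hy0.le
    · rw [lorentz_smul_right, hu, mul_zero]
    · rw [lorentz_smul_right, hy, abs_mul, abs_inv, abs_of_pos hy0]
      field_simp

/-- The determinant of Casey's matrix vanishes iff the vectors `(w i, 1)` are dependent or a
nonzero isotropic `(y, t)` satisfies `⟨w i, y⟩ = t` for all `i`. -/
lemma casey_det_eq_zero_iff (w : Fin (n + 1) → Fin (n + 1) → ℝ) :
    (Matrix.of fun i j => (lorentz (w i) (w j) - 1) / 2).det = 0 ↔
      ¬ LinearIndependent ℝ (fun i => (w i, (1 : ℝ))) ∨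
      ∃ x : (Fin (n + 1) → ℝ) × ℝ, x ≠ 0 ∧ extendedForm n x x = 0 ∧
        ∀ i, lorentz (w i) x.1 = x.2 := by
  have hM : (Matrix.of fun i j => (lorentz (w i) (w j) - 1) / 2) =
      (2⁻¹ : ℝ) • Matrix.of fun i j => extendedForm n (w i, 1) (w j, 1) := by
    ext i j
    simp [extendedForm_apply]
    ring
  rw [hM, Matrix.det_smul, mul_eq_zero_iff_left (by positivity),
    gram_det_eq_zero_iff (extendedForm_nondegenerate n) (extendedForm_isRefl n)
      (fun i => (w i, (1 : ℝ))) (by simp)]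
  simp [extendedForm_apply, sub_eq_zero]

lemma not_linearIndependent_iff_exists_pair (w : Fin (n + 1) → Fin (n + 1) → ℝ) :
    ¬ LinearIndependent ℝ (fun i => (w i, (1 : ℝ))) ↔
      ∃ p q : (Fin (n + 1) → ℝ) × ℝ, LinearIndependent ℝ ![p, q] ∧
        (∀ i, lorentz (w i) p.1 = p.2) ∧ ∀ i, lorentz (w i) q.1 = q.2 := by
  have hmem : ∀ x : (Fin (n + 1) → ℝ) × ℝ, x ∈ (extendedForm n).orthogonal
      (Submodule.span ℝ (Set.range fun i => (w i, (1 : ℝ)))) ↔ ∀ i, lorentz (w i) x.1 = x.2 := by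
    intro x
    rw [mem_orthogonal_span_range_iff]
    simp [extendedForm_apply, sub_eq_zero]
  rw [not_linearIndependent_iff_one_lt_finrank_orthogonal (extendedForm_nondegenerate n) _
    (by simp)]
  constructor
  · intro h
    have : Nontrivial ((extendedForm n).orthogonal
      (Submodule.span ℝ (Set.range fun i => (w i, (1 : ℝ))))) :=
      nontrivial_of_finrank_pos (R := ℝ) (by omega)
    obtain ⟨p, hp⟩ := exists_ne (0 : (extendedForm n).orthogonal
      (Submodule.span ℝ (Set.range fun i => (w i, (1 : ℝ)))))
    obtain ⟨q, hpq⟩ := exists_linearIndependent_pair_of_one_lt_finrank h hp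
    refine ⟨p, q, ?_, (hmem p).1 p.2, (hmem q).1 q.2⟩
    rw [LinearIndependent.pair_iff] at hpq ⊢
    exact fun s t hst => hpq s t (Subtype.ext hst)
  · rintro ⟨p, q, hpq, hp, hq⟩
    have hsub : LinearIndependent ℝ ![(⟨p, (hmem p).2 hp⟩ : (extendedForm n).orthogonal
        (Submodule.span ℝ (Set.range fun i => (w i, (1 : ℝ))))), ⟨q, (hmem q).2 hq⟩] := by
      rw [LinearIndependent.pair_iff] at hpq ⊢
      exact fun s t hst => hpq s t (congrArg Subtype.val hst)
    have hcard := hsub.fintype_card_le_finrank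
    rwa [Fintype.card_fin] at hcard

end Lorentz

lemma exists_sign_mul_eq_abs (a : ℝ) : ∃ e : ℝ, (e = 1 ∨ e = -1) ∧ e * a = |a| := by
  rcases abs_choice a with h | h
  · exact ⟨1, .inl rfl, by rw [h, one_mul]⟩
  · exact ⟨-1, .inr rfl, by rw [h, neg_one_mul]⟩

end Casey

/-- Casey's theorem, Lorentzian form: for spacelike unit vectors
`v₁, …, v_{n+1}` in `ℝ^{n,1}`, there are signs `ε_i ∈ {1, −1}` with `det C = 0`, where
`C_{ij} = ½(ε_i ε_j ⟨v_i, v_j⟩ − 1)`, iff (i) some `v` with `‖v‖² = 1` has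
`|⟨v_i, v⟩| = 1` for all `i`, or (ii) some nonzero lightlike `w` has `⟨v_i, w⟩ = 0` for
all `i`, or (iii) there are linearly independent unit spacelike `u, v` and `0 ≤ λ < 1`
with `⟨v_i, u⟩ = 0` and `|⟨v_i, v⟩| = λ` for all `i`. -/
theorem stmt14 (n : ℕ) (hn : 2 ≤ n) (v : Fin (n + 1) → (Fin (n + 1) → ℝ))
    (hv : ∀ i, lorentz (v i) (v i) = 1) :
    (∃ ε : Fin (n + 1) → ℝ, (∀ i, ε i = 1 ∨ ε i = -1) ∧
      Matrix.det (Matrix.of fun i j : Fin (n + 1) =>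
        (ε i * ε j * lorentz (v i) (v j) - 1) / 2) = 0) ↔
      ((∃ w : Fin (n + 1) → ℝ, lorentz w w = 1 ∧ ∀ i, |lorentz (v i) w| = 1) ∨
       (∃ w : Fin (n + 1) → ℝ, w ≠ 0 ∧ lorentz w w = 0 ∧ ∀ i, lorentz (v i) w = 0) ∨
       (∃ (u w : Fin (n + 1) → ℝ) (lam : ℝ), LinearIndependent ℝ ![u, w] ∧
          lorentz u u = 1 ∧ lorentz w w = 1 ∧ 0 ≤ lam ∧ lam < 1 ∧
          ∀ i, lorentz (v i) u = 0 ∧ |lorentz (v i) w| = lam)) := by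
  have hC : ∀ ε : Fin (n + 1) → ℝ,
      (Matrix.of fun i j : Fin (n + 1) => (ε i * ε j * lorentz (v i) (v j) - 1) / 2) =
      Matrix.of fun i j => (lorentz (ε i • v i) (ε j • v j) - 1) / 2 := by
    intro ε
    ext i j
    simp only [Matrix.of_apply, Casey.lorentz_smul_left, Casey.lorentz_smul_right]
    ring
  simp only [hC, Casey.casey_det_eq_zero_iff]
  constructor
  · rintro ⟨ε, hε, h⟩
    have habs : ∀ i, |ε i| = 1 := fun i => by rcases hε i with h | h <;> simp [h]
    have hne : ∀ i, ε i ≠ 0 := fun i => by rcases hε i with h | h <;> simp [h]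
    have hw : ∀ i, lorentz (ε i • v i) (ε i • v i) = 1 := fun i => by
      rw [Casey.lorentz_smul_left, Casey.lorentz_smul_right, hv]
      rcases hε i with h | h <;> simp [h]
    have hvw : ∀ i y, |lorentz (v i) y| = |lorentz (ε i • v i) y| := fun i y => by
      rw [Casey.lorentz_smul_left, abs_mul, habs, one_mul]
    replace h : _ ∨ _ := h.elim (fun h => by
      obtain ⟨p, q, hpq, hp, hq⟩ := (Casey.not_linearIndependent_iff_exists_pair _).1 h
      exact (Casey.exists_isotropic_or_exists_orthogonal_pair hw hpq hp hq)) Or.inl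
    rcases h with ⟨⟨y, t⟩, hx0, hxx, hx⟩ | ⟨u, y, lam, hli, huu, hyy, h0, h1, h⟩
    · simp only [Casey.extendedForm_apply] at hx hxx
      by_cases ht : t = 0
      · subst ht
        refine .inr (.inl ⟨y, fun h => hx0 (by rw [h]; rfl), by simpa using hxx, fun i => ?_⟩)
        rw [← abs_eq_zero, hvw, hx, abs_zero]
      · refine .inl ⟨t⁻¹ • y, ?_, fun i => ?_⟩
        · rw [Casey.lorentz_smul_left, Casey.lorentz_smul_right, sub_eq_zero.1 hxx]
          field_simp
        · rw [hvw, Casey.lorentz_smul_right, hx, inv_mul_cancel₀ ht, abs_one]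
    · refine .inr (.inr ⟨u, y, lam, hli, huu, hyy, h0, h1, fun i => ⟨?_, ?_⟩⟩)
      · rw [← abs_eq_zero, hvw, (h i).1, abs_zero]
      · rw [hvw, (h i).2]
  · rintro (⟨y, hyy, hy⟩ | ⟨y, hy0, hyy, hy⟩ | ⟨u, y, lam, hli, huu, hyy, h0, h1, h⟩)
    · choose ε hε he using fun i => Casey.exists_sign_mul_eq_abs (lorentz (v i) y)
      refine ⟨ε, hε, .inr ⟨(y, 1), fun h => one_ne_zero (congrArg Prod.snd h), ?_, fun i => ?_⟩⟩
      · simp [Casey.extendedForm_apply, hyy]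
      · rw [Casey.lorentz_smul_left, he, hy]
    · refine ⟨fun _ => 1, fun _ => .inl rfl, .inr ⟨(y, 0), fun h => hy0 (congrArg Prod.fst h), ?_,
        fun i => ?_⟩⟩
      · simp [Casey.extendedForm_apply, hyy]
      · rw [Casey.lorentz_smul_left, hy, mul_zero]
    · choose ε hε he using fun i => Casey.exists_sign_mul_eq_abs (lorentz (v i) y)
      refine ⟨ε, hε, .inl ((Casey.not_linearIndependent_iff_exists_pair _).2
        ⟨(u, 0), (y, lam), ?_, fun i => ?_, fun i => ?_⟩)⟩
      · rw [LinearIndependent.pair_iff] at hli ⊢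
        exact fun s t hst => hli s t (congrArg Prod.fst hst)
      · rw [Casey.lorentz_smul_left, (h i).1, mul_zero]
      · rw [Casey.lorentz_smul_left, he, (h i).2]
end
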